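/- In the hyperbolic upper half-plane ℍ, for every real t > 0 one has dist(√3·i, 1 + t·i) ≥ (1/2)·log 3, and equality holds if and only if t = 2. In other words, the hyperbolic distance from the point √3·i to the geodesic side {z ∈ ℍ : Re z = 1} of the ideal triangle with ideal vertices −1, 1, ∞ equals (1/2)·log 3 and is attained exactly at the point 1 + 2i. -/

import Mathlib

open UpperHalfPlane Complex

/-- For every `t > 0`, the hyperbolic distance from `√3·i` to the point `1 + t·i` on the
geodesic side `{Re z = 1}` of the ideal triangle with ideal vertices `-1, 1, ∞` is at
least `(1/2)·log 3`, with equality if and only if `t = 2`. -/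
theorem dist_sqrt_three_i_to_vertical_side (t : ℝ) (ht : 0 < t) :
    (1 / 2) * Real.log 3 ≤
        dist (⟨(Real.sqrt 3 : ℂ) * Complex.I, by
          simp [Real.sqrt_pos]⟩ : ℍ)
          (⟨1 + (t : ℂ) * Complex.I, by simpa using ht⟩ : ℍ) ∧
      (dist (⟨(Real.sqrt 3 : ℂ) * Complex.I, by
          simp [Real.sqrt_pos]⟩ : ℍ)
          (⟨1 + (t : ℂ) * Complex.I, by simpa using ht⟩ : ℍ) =
        (1 / 2) * Real.log 3 ↔ t = 2) := by
  have hs : 0 < Real.sqrt 3 := by positivity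
  have hs2 : Real.sqrt 3 * Real.sqrt 3 = 3 := Real.mul_self_sqrt (by norm_num)
  have hL : (1 / 2) * Real.log 3 = Real.log (Real.sqrt 3) := by
    rw [Real.log_sqrt (by norm_num)]; ring
  have hLpos : 0 ≤ (1 / 2) * Real.log 3 := by
    have := Real.log_nonneg (show (1 : ℝ) ≤ 3 by norm_num)
    positivity
  have hcL : Real.cosh ((1 / 2) * Real.log 3) = 2 / Real.sqrt 3 := by
    rw [hL, Real.cosh_log hs]
    field_simp
    nlinarith
  generalize hd : dist (⟨(Real.sqrt 3 : ℂ) * Complex.I, by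
          simp [Real.sqrt_pos]⟩ : ℍ)
          (⟨1 + (t : ℂ) * Complex.I, by simpa using ht⟩ : ℍ) = d
  have hd0 : 0 ≤ d := hd ▸ dist_nonneg
  have hcd : Real.cosh d = 2 / Real.sqrt 3 + (t - 2) ^ 2 / (2 * Real.sqrt 3 * t) := by
    rw [← hd, UpperHalfPlane.cosh_dist']
    simp only [UpperHalfPlane.re, UpperHalfPlane.im]
    simp
    field_simp
    nlinarith
  have hle : (1 / 2) * Real.log 3 ≤ d := by
    rw [← abs_of_nonneg hLpos, ← abs_of_nonneg hd0, ← Real.cosh_le_cosh, hcL, hcd]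
    have : 0 ≤ (t - 2) ^ 2 / (2 * Real.sqrt 3 * t) := by positivity
    linarith
  refine ⟨hle, ?_, ?_⟩
  · intro h
    rw [h, hcL] at hcd
    have h0 : (t - 2) ^ 2 / (2 * Real.sqrt 3 * t) = 0 := by linarith
    have hne : 2 * Real.sqrt 3 * t ≠ 0 := by positivity
    rcases div_eq_zero_iff.mp h0 with h1 | h1
    · have := pow_eq_zero_iff (two_ne_zero) |>.mp h1
      linarith
    · exact absurd h1 hne
  · intro h
    apply le_antisymm _ hle
    rw [← abs_of_nonneg hLpos, ← abs_of_nonneg hd0, ← Real.cosh_le_cosh, hcL, hcd, h]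
    simp
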